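/- For every d ≥ 1 and every ε > 0 there exist smooth vector fields X₁, …, X_d on ℝ^d (smooth maps ℝ^d → ℝ^d) such that: the support of each X_α is contained in the closed ball of radius ε around the origin; the fields pairwise commute, i.e. [X_α, X_β] = 0 for all α, β; and X_α(0) = e_α, the α-th standard basis vector of ℝ^d. -/

import Mathlib

/-- The Lie bracket of smooth vector fields on a normed vector space:
`[X, Y](v) = DY(v)·X(v) − DX(v)·Y(v)`. -/
noncomputable def lieB {W : Type*} [NormedAddCommGroup W] [NormedSpace ℝ W]
    (Z₁ Z₂ : W → W) (w : W) : W :=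
  fderiv ℝ Z₂ w (Z₁ w) - fderiv ℝ Z₁ w (Z₂ w)

open scoped RealInnerProductSpace in
/-- The vector field `x ↦ a(‖x‖²) e + c(‖x‖²) ⟪e, x⟫ x`. -/
noncomputable def radialField {E : Type*} [NormedAddCommGroup E] [InnerProductSpace ℝ E]
    (a c : ℝ → ℝ) (e x : E) : E :=
  a (‖x‖ ^ 2) • e + (c (‖x‖ ^ 2) * ⟪e, x⟫) • x

open scoped RealInnerProductSpace in
theorem fderiv_radialField {E : Type*} [NormedAddCommGroup E] [InnerProductSpace ℝ E]
    {a c : ℝ → ℝ} {a' c' : ℝ} {x : E} (ha : HasDerivAt a a' (‖x‖ ^ 2))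
    (hc : HasDerivAt c c' (‖x‖ ^ 2)) (e v : E) :
    fderiv ℝ (radialField a c e) x v =
      (a' * (2 * ⟪x, v⟫)) • e + (c (‖x‖ ^ 2) * ⟪e, x⟫) • v +
        (c (‖x‖ ^ 2) * ⟪e, v⟫ + c' * (2 * ⟪x, v⟫) * ⟪e, x⟫) • x := by
  have hs : HasFDerivAt (fun y : E => ‖y‖ ^ 2) (2 • innerSL ℝ x) x :=
    (hasStrictFDerivAt_norm_sq x).hasFDerivAt
  have h₁ := (ha.comp_hasFDerivAt x hs).smul_const e
  have h₂ := ((hc.comp_hasFDerivAt x hs).mul (innerSL ℝ e).hasFDerivAt).smul (hasFDerivAt_id x)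
  have h : HasFDerivAt (radialField a c e) _ x := h₁.add h₂
  rw [h.fderiv]
  simp
  module

open scoped RealInnerProductSpace in
theorem lieB_radialField {E : Type*} [NormedAddCommGroup E] [InnerProductSpace ℝ E]
    {a c : ℝ → ℝ} {a' c' : ℝ} {x : E} (ha : HasDerivAt a a' (‖x‖ ^ 2))
    (hc : HasDerivAt c c' (‖x‖ ^ 2))
    (h : 2 * a' * (a (‖x‖ ^ 2) + c (‖x‖ ^ 2) * ‖x‖ ^ 2) = c (‖x‖ ^ 2) * a (‖x‖ ^ 2)) (e f : E) :
    lieB (radialField a c e) (radialField a c f) x = 0 := by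
  rw [lieB, fderiv_radialField ha hc, fderiv_radialField ha hc]
  simp only [radialField, inner_add_right, inner_smul_right, real_inner_self_eq_norm_sq,
    real_inner_comm e x, real_inner_comm f x, real_inner_comm e f]
  linear_combination (norm := module) h • (⟪e, x⟫ • f - ⟪f, x⟫ • e)

theorem expNegInvGlue.hasDerivAt (t : ℝ) :
    HasDerivAt expNegInvGlue (t⁻¹ ^ 2 * expNegInvGlue t) t := by
  simpa using expNegInvGlue.hasDerivAt_polynomial_eval_inv_mul 1 t

/-- For every `d ≥ 1` and `ε > 0` there are smooth vector fields `X₁, …, X_d` on `ℝ^d`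
supported in the closed ball of radius `ε` around the origin, pairwise commuting, and
with `X_α(0) = e_α` the `α`-th standard basis vector. -/
theorem stmt15 (d : ℕ) (hd : 1 ≤ d) (ε : ℝ) (hε : 0 < ε) :
    ∃ X : Fin d → EuclideanSpace ℝ (Fin d) → EuclideanSpace ℝ (Fin d),
      (∀ α, ContDiff ℝ (⊤ : ℕ∞) (X α)) ∧
      (∀ α, tsupport (X α) ⊆ Metric.closedBall 0 ε) ∧
      (∀ α β, lieB (X α) (X β) = 0) ∧
      (∀ α, X α 0 = EuclideanSpace.single α 1) := by
  set a : ℝ → ℝ := fun r => Real.exp 1 * expNegInvGlue (1 - r / ε ^ 2) with ha_def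
  set c : ℝ → ℝ := fun r => -2 * ε ^ 2 * a r / (ε ^ 4 + r ^ 2) with hc_def
  have hden : ∀ r : ℝ, ε ^ 4 + r ^ 2 ≠ 0 := fun r => by positivity
  have ha : ContDiff ℝ (⊤ : ℕ∞) a :=
    contDiff_const.mul (expNegInvGlue.contDiff.comp (by fun_prop))
  have hc : ContDiff ℝ (⊤ : ℕ∞) c :=
    (contDiff_const.mul ha).div (by fun_prop) hden
  refine ⟨fun α => radialField a c (EuclideanSpace.single α 1), fun α => ?_, fun α => ?_,
    fun α β => funext fun x => ?_, fun α => ?_⟩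
  · have hs : ContDiff ℝ (⊤ : ℕ∞) fun x : EuclideanSpace ℝ (Fin d) => ‖x‖ ^ 2 :=
      contDiff_norm_sq ℝ
    exact ((ha.comp hs).smul contDiff_const).add
      (((hc.comp hs).mul (contDiff_const.inner ℝ contDiff_id)).smul contDiff_id)
  · refine closure_minimal (fun x hx => ?_) Metric.isClosed_closedBall
    contrapose! hx
    rw [mem_closedBall_zero_iff, not_le] at hx
    have h0 : a (‖x‖ ^ 2) = 0 := by
      have : 1 ≤ ‖x‖ ^ 2 / ε ^ 2 := (one_le_div (by positivity)).2 (by gcongr)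
      simp [ha_def, expNegInvGlue.zero_of_nonpos (sub_nonpos.2 this)]
    simp [radialField, hc_def, h0]
  · set r := ‖x‖ ^ 2
    have ha' : HasDerivAt a
        (Real.exp 1 * ((1 - r / ε ^ 2)⁻¹ ^ 2 * expNegInvGlue (1 - r / ε ^ 2) * -(1 / ε ^ 2))) r :=
      ((expNegInvGlue.hasDerivAt _).comp r
        (((hasDerivAt_id r).div_const _).const_sub 1)).const_mul _
    refine lieB_radialField ha' (hc.differentiable (by simp) _).hasDerivAt ?_ _ _
    change 2 * _ * (a r + c r * r) = c r * a r
    rcases eq_or_ne (1 - r / ε ^ 2) 0 with h | h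
    · simp [hc_def, ha_def, h]
    · have hd := hden r
      have h' : ε ^ 2 - r ≠ 0 := fun h0 => h (by rw [← sub_eq_zero.1 h0]; field_simp; simp)
      simp only [hc_def, ha_def]
      generalize expNegInvGlue (1 - r / ε ^ 2) = g
      have : 1 - r / ε ^ 2 = (ε ^ 2 - r) / ε ^ 2 := by field_simp
      rw [this]
      field_simp
      ring
  · simp [radialField, ha_def, expNegInvGlue, ← Real.exp_add]
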